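/- arXiv:1402.6748 — 3 statements merged into one kernel-verified Lean document; each statement's English description precedes it below -/
import Mathlib

section
/- For every 3×3 real matrix B, the matrix-valued function ε ↦ det(I + εB) · (I + εB)^{-1} (I + εB)^{-⊤}, defined for all ε in a neighborhood of 0 where I + εB is invertible, is differentiable at ε = 0, and its derivative at ε = 0 equals tr(B)·I − B − Bᵀ. -/
open Matrix

attribute [local instance] Matrix.normedAddCommGroup Matrix.normedSpace

theorem Matrix.hasDerivAt_det_one_add_smul {n : Type*} [Fintype n] [DecidableEq n]
    (B : Matrix n n ℝ) :
    HasDerivAt (fun ε : ℝ => (1 + ε • B).det) B.trace 0 := by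
  let p := (Matrix.det (1 + (Polynomial.X : Polynomial ℝ) • B.map Polynomial.C)).divX.divX
  have h := (((hasDerivAt_id (0 : ℝ)).const_mul B.trace).const_add 1).add
    ((p.hasDerivAt 0).mul ((hasDerivAt_id (0 : ℝ)).pow 2))
  refine (h.congr_of_eventuallyEq (.of_forall fun ε => ?_)).congr_deriv (by simp)
  exact Matrix.det_one_add_smul ε B

theorem Matrix.hasDerivAt_adjugate_one_add_smul_apply (B : Matrix (Fin 3) (Fin 3) ℝ)
    (i j : Fin 3) :
    HasDerivAt (fun ε : ℝ => (1 + ε • B).adjugate i j)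
      ((B.trace • (1 : Matrix (Fin 3) (Fin 3) ℝ) - B) i j) 0 := by
  have entry (k l : Fin 3) :
      HasDerivAt (fun ε : ℝ => (1 + ε • B) k l) (B k l) 0 := by
    simpa using ((hasDerivAt_id (0 : ℝ)).mul_const (B k l)).const_add
      ((1 : Matrix (Fin 3) (Fin 3) ℝ) k l)
  have minor (a b c d e f g h : Fin 3) :=
    ((entry a b).mul (entry c d)).sub ((entry e f).mul (entry g h))
  have minor_neg (a b c d e f g h : Fin 3) :=
    ((entry a b).mul (entry c d)).neg.add ((entry e f).mul (entry g h))
  simp only [Matrix.adjugate_fin_three]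
  fin_cases i <;> fin_cases j <;>
    first
    | (refine (minor _ _ _ _ _ _ _ _).congr_deriv ?_
       simp [Matrix.trace_fin_three]; try ring)
    | (refine (minor_neg _ _ _ _ _ _ _ _).congr_deriv ?_
       simp [Matrix.trace_fin_three]; try ring)

/-- For every 3×3 real matrix `B`, the matrix-valued map
`ε ↦ det(I + εB) • (I + εB)⁻¹ (I + εB)⁻ᵀ` is differentiable at `ε = 0` with
derivative `tr(B)·I − B − Bᵀ`. -/
theorem stmt4 (B : Matrix (Fin 3) (Fin 3) ℝ) :
    HasDerivAt
      (fun ε : ℝ => (1 + ε • B).det • ((1 + ε • B)⁻¹ * ((1 + ε • B)⁻¹)ᵀ))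
      (B.trace • (1 : Matrix (Fin 3) (Fin 3) ℝ) - B - Bᵀ) 0 := by
  refine hasDerivAt_pi.2 fun i => hasDerivAt_pi.2 fun j => ?_
  have hdet := Matrix.hasDerivAt_det_one_add_smul B
  have hadj := Matrix.hasDerivAt_adjugate_one_add_smul_apply B
  have hinv := hdet.inv (by simp)
  have hsum := HasDerivAt.fun_sum (u := Finset.univ)
    fun k _ => (hinv.mul (hadj i k)).mul (hinv.mul (hadj j k))
  convert! hdet.mul hsum using 1
  · ext ε
    simp [Matrix.inv_def, Matrix.mul_apply, Ring.inverse_eq_inv', Finset.mul_sum, mul_assoc,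
      mul_left_comm]
  · fin_cases i <;> fin_cases j <;>
      simp [Fin.sum_univ_three, Matrix.trace_fin_three] <;> ring
end

section
/- Let V : ℝ³ → ℝ³ be a continuously differentiable vector field that vanishes outside a closed ball B_R = {x ∈ ℝ³ : |x| ≤ R}, and for sufficiently small ε > 0 set A(ε,x) = γ(ε,x) J_{T^ε}(x)^{-1} J_{T^ε}(x)^{-⊤}, where J_{T^ε}(x) = I + ε DV(x) and γ(ε,x) = det(I + ε DV(x)). Define A'(0,x) = (div V(x))·I − DV(x) − DV(x)ᵀ. Then lim_{ε → 0⁺} ∫_{ℝ³} |(A(ε,x) − I)/ε − A'(0,x)|² dx = 0, i.e. the difference quotients (A(ε,·) − I)/ε converge to A'(0,·) in L²(ℝ³) (entrywise). -/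
open Matrix MeasureTheory Filter

attribute [local instance] Matrix.normedAddCommGroup Matrix.normedSpace

/-- The Jacobian matrix `DV(x)` of a map `V : ℝ³ → ℝ³`, with entries
`(DV(x))_{ij} = ∂_j V_i(x)`. -/
noncomputable def jacMatrix (V : EuclideanSpace ℝ (Fin 3) → EuclideanSpace ℝ (Fin 3))
    (x : EuclideanSpace ℝ (Fin 3)) : Matrix (Fin 3) (Fin 3) ℝ :=
  Matrix.of fun i j => fderiv ℝ V x (EuclideanSpace.single j (1 : ℝ)) i

/-- The matrix `A(ε,x) = γ(ε,x) J_{T^ε}(x)⁻¹ J_{T^ε}(x)⁻ᵀ`, where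
`J_{T^ε}(x) = I + ε DV(x)` and `γ(ε,x) = det(I + ε DV(x))`. -/
noncomputable def matA (V : EuclideanSpace ℝ (Fin 3) → EuclideanSpace ℝ (Fin 3))
    (ε : ℝ) (x : EuclideanSpace ℝ (Fin 3)) : Matrix (Fin 3) (Fin 3) ℝ :=
  (1 + ε • jacMatrix V x).det •
    ((1 + ε • jacMatrix V x)⁻¹ * ((1 + ε • jacMatrix V x)⁻¹)ᵀ)

/-- The Gâteaux derivative `A'(0,x) = (div V(x))·I − DV(x) − DV(x)ᵀ`. -/
noncomputable def matA' (V : EuclideanSpace ℝ (Fin 3) → EuclideanSpace ℝ (Fin 3))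
    (x : EuclideanSpace ℝ (Fin 3)) : Matrix (Fin 3) (Fin 3) ℝ :=
  (jacMatrix V x).trace • (1 : Matrix (Fin 3) (Fin 3) ℝ)
    - jacMatrix V x - (jacMatrix V x)ᵀ

/-- The quadratic remainder in the expansion of `(1 + ε • M)⁻¹ * ((1 + ε • M)⁻¹)ᵀ` at `ε = 0`. -/
noncomputable def gramInvRemainder (ε : ℝ) (M : Matrix (Fin 3) (Fin 3) ℝ) :
    Matrix (Fin 3) (Fin 3) ℝ :=
  M * Mᵀ + M * M * (1 + ε • M)⁻¹ + (M * M * (1 + ε • M)⁻¹)ᵀ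
    - ε • (M * (M * M * (1 + ε • M)⁻¹)ᵀ + M * M * (1 + ε • M)⁻¹ * Mᵀ)
    + ε ^ 2 • (M * M * (1 + ε • M)⁻¹ * (M * M * (1 + ε • M)⁻¹)ᵀ)

/-- The quadratic remainder in the expansion of `det (1 + ε • M)` at `ε = 0`. -/
noncomputable def detRemainder (ε : ℝ) (M : Matrix (Fin 3) (Fin 3) ℝ) : ℝ :=
  M.adjugate.trace + ε * M.det

theorem det_one_add_smul_fin_three (ε : ℝ) (M : Matrix (Fin 3) (Fin 3) ℝ) :
    (1 + ε • M).det = 1 + ε * M.trace + ε ^ 2 * detRemainder ε M := by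
  simp [detRemainder, Matrix.det_fin_three, Matrix.trace_fin_three, Matrix.adjugate_fin_three]
  ring

theorem gram_inv_one_add_smul {ε : ℝ} {M : Matrix (Fin 3) (Fin 3) ℝ}
    (h : (1 + ε • M).det ≠ 0) :
    (1 + ε • M)⁻¹ * ((1 + ε • M)⁻¹)ᵀ = 1 - ε • (M + Mᵀ) + ε ^ 2 • gramInvRemainder ε M := by
  have hmul : (1 + ε • M) * (1 + ε • M)⁻¹ = 1 :=
    Matrix.mul_nonsing_inv _ (isUnit_iff_ne_zero.mpr h)
  unfold gramInvRemainder
  generalize (1 + ε • M)⁻¹ = S at hmul ⊢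
  have hS : S = 1 - ε • (M * S) := by
    rw [add_mul, one_mul, smul_mul_assoc] at hmul
    exact eq_sub_of_add_eq hmul
  have hS' : S = 1 - ε • M + ε ^ 2 • (M * M * S) := by
    have hMS : M * S = M - ε • (M * M * S) := by
      conv_lhs => rw [hS]
      rw [mul_sub, mul_one, mul_smul_comm, mul_assoc]
    conv_lhs => rw [hS, hMS]
    module
  generalize M * M * S = W at hS' ⊢
  subst hS'
  simp only [Matrix.transpose_add, Matrix.transpose_sub, Matrix.transpose_smul,
    Matrix.transpose_one, add_mul, mul_add, sub_mul, mul_sub, smul_mul_assoc, mul_smul_comm,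
    one_mul, mul_one]
  module

/-- The difference quotient of `ε ↦ det (1 + ε • M) • (1 + ε • M)⁻¹ * ((1 + ε • M)⁻¹)ᵀ` at `0`
differs from `M.trace • 1 - M - Mᵀ` by `ε` times an explicit expression. -/
theorem diffQuotient_sub_eq {ε : ℝ} (hε : ε ≠ 0) {M : Matrix (Fin 3) (Fin 3) ℝ}
    (h : (1 + ε • M).det ≠ 0) :
    ε⁻¹ • ((1 + ε • M).det • ((1 + ε • M)⁻¹ * ((1 + ε • M)⁻¹)ᵀ) - 1)
        - (M.trace • (1 : Matrix (Fin 3) (Fin 3) ℝ) - M - Mᵀ) =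
      ε • (gramInvRemainder ε M - M.trace • (M + Mᵀ - ε • gramInvRemainder ε M)
        + detRemainder ε M • (1 - ε • (M + Mᵀ) + ε ^ 2 • gramInvRemainder ε M)) := by
  rw [gram_inv_one_add_smul h, det_one_add_smul_fin_three]
  generalize gramInvRemainder ε M = Y
  match_scalars <;> field_simp <;> ring

theorem continuousAt_inv_one_add_smul (M : Matrix (Fin 3) (Fin 3) ℝ) :
    ContinuousAt (fun p : Matrix (Fin 3) (Fin 3) ℝ × ℝ => (1 + p.2 • p.1)⁻¹) (M, 0) := by
  simp only [Matrix.inv_def, Ring.inverse_eq_inv']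
  have hbase : Continuous fun p : Matrix (Fin 3) (Fin 3) ℝ × ℝ => 1 + p.2 • p.1 := by fun_prop
  exact (hbase.matrix_det.continuousAt.inv₀ (by simp)).smul hbase.matrix_adjugate.continuousAt

theorem continuousAt_gramInvRemainder (M : Matrix (Fin 3) (Fin 3) ℝ) :
    ContinuousAt (fun p : Matrix (Fin 3) (Fin 3) ℝ × ℝ => gramInvRemainder p.2 p.1) (M, 0) := by
  have hg : Continuous fun q : (Matrix (Fin 3) (Fin 3) ℝ × ℝ) × Matrix (Fin 3) (Fin 3) ℝ =>
      q.1.1 * q.1.1ᵀ + q.1.1 * q.1.1 * q.2 + (q.1.1 * q.1.1 * q.2)ᵀ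
        - q.1.2 • (q.1.1 * (q.1.1 * q.1.1 * q.2)ᵀ + q.1.1 * q.1.1 * q.2 * q.1.1ᵀ)
        + q.1.2 ^ 2 • (q.1.1 * q.1.1 * q.2 * (q.1.1 * q.1.1 * q.2)ᵀ) := by
    fun_prop
  exact ContinuousAt.comp (f := fun p : Matrix (Fin 3) (Fin 3) ℝ × ℝ => (p, (1 + p.2 • p.1)⁻¹))
    hg.continuousAt (continuousAt_id.prodMk (continuousAt_inv_one_add_smul M))

theorem continuous_detRemainder :
    Continuous fun p : Matrix (Fin 3) (Fin 3) ℝ × ℝ => detRemainder p.2 p.1 := by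
  unfold detRemainder
  have hadj : Continuous fun p : Matrix (Fin 3) (Fin 3) ℝ × ℝ => p.1.adjugate :=
    continuous_fst.matrix_adjugate
  exact hadj.matrix_trace.add (by fun_prop)

/-- The difference quotients of `ε ↦ det (1 + ε • M) • (1 + ε • M)⁻¹ * ((1 + ε • M)⁻¹)ᵀ` at `0`
converge locally uniformly in `M`. -/
theorem eventually_norm_diffQuotient_sub_lt (M : Matrix (Fin 3) (Fin 3) ℝ) {η : ℝ} (hη : 0 < η) :
    ∀ᶠ p : Matrix (Fin 3) (Fin 3) ℝ × ℝ in nhds (M, 0), p.2 ≠ 0 →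
      ‖p.2⁻¹ • ((1 + p.2 • p.1).det • ((1 + p.2 • p.1)⁻¹ * ((1 + p.2 • p.1)⁻¹)ᵀ) - 1)
        - (p.1.trace • (1 : Matrix (Fin 3) (Fin 3) ℝ) - p.1 - p.1ᵀ)‖ < η := by
  have hY := continuousAt_gramInvRemainder M
  have hr := (continuous_detRemainder.continuousAt (x := (M, (0 : ℝ))))
  have hg : Continuous fun q : (Matrix (Fin 3) (Fin 3) ℝ × ℝ) × Matrix (Fin 3) (Fin 3) ℝ × ℝ =>
      q.1.2 • (q.2.1 - q.1.1.trace • (q.1.1 + q.1.1ᵀ - q.1.2 • q.2.1)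
        + q.2.2 • (1 - q.1.2 • (q.1.1 + q.1.1ᵀ) + q.1.2 ^ 2 • q.2.1)) := by
    fun_prop
  have hc := ContinuousAt.comp
    (f := fun p : Matrix (Fin 3) (Fin 3) ℝ × ℝ =>
      (p, gramInvRemainder p.2 p.1, detRemainder p.2 p.1))
    hg.continuousAt (continuousAt_id.prodMk (hY.prodMk hr))
  have hsmall := hc.norm.eventually_lt_const (u := η) (by simpa using hη)
  have hdet : Continuous fun p : Matrix (Fin 3) (Fin 3) ℝ × ℝ => (1 + p.2 • p.1).det := by
    fun_prop
  filter_upwards [hsmall, hdet.continuousAt.eventually_ne (y := 0) (by simp)] with p hp hd h0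
  rw [diffQuotient_sub_eq h0 hd]
  exact hp

theorem continuous_jacMatrix {V : EuclideanSpace ℝ (Fin 3) → EuclideanSpace ℝ (Fin 3)}
    (hV : ContDiff ℝ 1 V) : Continuous (jacMatrix V) := by
  have hd : Continuous (fderiv ℝ V) := hV.continuous_fderiv one_ne_zero
  refine continuous_matrix fun i j => ?_
  simp only [jacMatrix, Matrix.of_apply]
  fun_prop

theorem jacMatrix_eq_zero {V : EuclideanSpace ℝ (Fin 3) → EuclideanSpace ℝ (Fin 3)} {s : Set _}
    (hs : IsClosed s) (hsupp : ∀ x ∉ s, V x = 0) {x : EuclideanSpace ℝ (Fin 3)} (hx : x ∉ s) :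
    jacMatrix V x = 0 := by
  have h : V =ᶠ[nhds x] fun _ => 0 := by
    filter_upwards [hs.isOpen_compl.mem_nhds hx] with y hy using hsupp y hy
  ext i j
  simp [jacMatrix, h.fderiv_eq]

/-- If `V : ℝ³ → ℝ³` is `C¹` and vanishes outside a closed ball `B_R`, then
`∫_{ℝ³} |(A(ε,x) − I)/ε − A'(0,x)|² dx → 0` as `ε → 0⁺`, i.e. the difference quotients
converge to `A'(0,·)` in `L²(ℝ³)`. -/
theorem stmt6 (R : ℝ)
    (V : EuclideanSpace ℝ (Fin 3) → EuclideanSpace ℝ (Fin 3))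
    (hV : ContDiff ℝ 1 V)
    (hsupp : ∀ x ∉ Metric.closedBall (0 : EuclideanSpace ℝ (Fin 3)) R, V x = 0) :
    Tendsto (fun ε : ℝ => ∫ x, ‖ε⁻¹ • (matA V ε x - 1) - matA' V x‖ ^ 2)
      (nhdsWithin 0 (Set.Ioi 0)) (nhds 0) := by
  set B := Metric.closedBall (0 : EuclideanSpace ℝ (Fin 3)) R
  have hsupport (ε : ℝ) (x) (hx : x ∉ B) : ‖ε⁻¹ • (matA V ε x - 1) - matA' V x‖ ^ 2 = 0 := by
    simp [matA, matA', jacMatrix_eq_zero Metric.isClosed_closedBall hsupp hx]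
  have hunif {η : ℝ} (hη : 0 < η) : ∀ᶠ ε in nhdsWithin (0 : ℝ) (Set.Ioi 0),
      ∀ x ∈ B, ‖ε⁻¹ • (matA V ε x - 1) - matA' V x‖ < η := by
    have hloc : ∀ᶠ ε in nhds (0 : ℝ), ∀ x ∈ B, ε ≠ 0 →
        ‖ε⁻¹ • (matA V ε x - 1) - matA' V x‖ < η := by
      refine (isCompact_closedBall _ _).eventually_forall_of_forall_eventually fun x _ => ?_
      have hc : Continuous fun p : ℝ × EuclideanSpace ℝ (Fin 3) => (jacMatrix V p.2, p.1) :=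
        ((continuous_jacMatrix hV).comp continuous_snd).prodMk continuous_fst
      exact (hc.tendsto (0, x)).eventually (eventually_norm_diffQuotient_sub_lt _ hη)
    filter_upwards [nhdsWithin_le_nhds hloc, self_mem_nhdsWithin] with ε h hε x hx
    exact h x hx (ne_of_gt hε)
  rw [Metric.tendsto_nhds]
  intro δ hδ
  obtain ⟨η, hη, hηδ⟩ : ∃ η : ℝ, 0 < η ∧ η ^ 2 * volume.real B < δ := by
    have hc : Tendsto (fun η : ℝ => η ^ 2 * volume.real B) (nhdsWithin 0 (Set.Ioi 0)) (nhds 0) :=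
      (Continuous.tendsto' (by fun_prop) 0 0 (by simp)).mono_left nhdsWithin_le_nhds
    obtain ⟨η, h, hη⟩ := ((hc.eventually_lt_const hδ).and self_mem_nhdsWithin).exists
    exact ⟨η, hη, h⟩
  filter_upwards [hunif hη] with ε hε
  rw [dist_zero_right, ← setIntegral_eq_integral_of_forall_compl_eq_zero (hsupport ε)]
  refine lt_of_le_of_lt (norm_setIntegral_le_of_norm_le_const
    measure_closedBall_lt_top fun x hx => ?_) hηδ
  rw [norm_pow, norm_norm]
  exact pow_le_pow_left₀ (norm_nonneg _) (hε x hx).le 2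
end

section
/- Let n ∈ ℝ³ be a unit vector, g ∈ ℝ³, and let B be the 3×3 matrix with Bᵀ = g nᵀ (i.e. B = n gᵀ). Then the derivative at ε = 0 of the map ε ↦ (I + εB)^{-⊤} n / |(I + εB)^{-⊤} n| equals −g + ⟨g, n⟩ n, i.e. the negative of the component of g orthogonal to n. -/
open Matrix
open scoped RealInnerProductSpace

/-- The derivative of a normalized curve at a point where the curve has norm one is the component
of the velocity orthogonal to the curve. -/
theorem HasDerivAt.norm_inv_smul_of_norm_eq_one {E : Type*} [NormedAddCommGroup E]
    [InnerProductSpace ℝ E] {v : ℝ → E} {v' : E} {x : ℝ} (hv : HasDerivAt v v' x)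
    (hx : ‖v x‖ = 1) :
    HasDerivAt (fun t => ‖v t‖⁻¹ • v t) (v' - ⟪v x, v'⟫ • v x) x := by
  have hsqrt := hv.norm_sq.sqrt (by simp [hx])
  have hnorm : HasDerivAt (fun t => ‖v t‖) ⟪v x, v'⟫ x := by
    simpa [hx] using hsqrt
  have h := (hnorm.fun_inv (by simp [hx])).fun_smul hv
  convert h using 1
  simp [hx, sub_eq_add_neg]

/-- The Sherman–Morrison formula for a rank-one perturbation of the identity. -/
theorem Matrix.inv_one_add_smul_vecMulVec {m K : Type*} [Fintype m] [DecidableEq m] [Field K]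
    (u w : m → K) (t : K) (h : 1 + t * (w ⬝ᵥ u) ≠ 0) :
    (1 + t • vecMulVec u w)⁻¹ = 1 - (t / (1 + t * (w ⬝ᵥ u))) • vecMulVec u w := by
  apply Matrix.inv_eq_right_inv
  have hsq : vecMulVec u w * vecMulVec u w = (w ⬝ᵥ u) • vecMulVec u w := by
    rw [vecMulVec_mul_vecMulVec, vecMulVec_smul]
  rw [add_mul, one_mul, mul_sub, mul_one, smul_mul_smul_comm, hsq]
  match_scalars
  · simp
  · field_simp
    ring

/-- Let `n ∈ ℝ³` be a unit vector, `g ∈ ℝ³`, and let `B` be the 3×3 matrix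
with `Bᵀ = g nᵀ`, i.e. `B = n gᵀ` (entrywise `B i j = n i * g j`). Then the derivative at
`ε = 0` of `ε ↦ (I + εB)^{-⊤} n / |(I + εB)^{-⊤} n|` equals `−g + ⟨g, n⟩ n`, the
negative of the component of `g` orthogonal to `n`. -/
theorem stmt13 (n g : EuclideanSpace ℝ (Fin 3)) (hn : ‖n‖ = 1)
    (B : Matrix (Fin 3) (Fin 3) ℝ)
    (hB : B = Matrix.of fun i j => n i * g j) :
    HasDerivAt
      (fun ε : ℝ =>
        ‖Matrix.toEuclideanLin (((1 + ε • B)⁻¹)ᵀ) n‖⁻¹ •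
          Matrix.toEuclideanLin (((1 + ε • B)⁻¹)ᵀ) n)
      (-g + ⟪g, n⟫ • n) 0 := by
  have hB' : B = vecMulVec n.ofLp g.ofLp := hB
  set s : ℝ := g.ofLp ⬝ᵥ n.ofLp
  have hnn : n.ofLp ⬝ᵥ n.ofLp = 1 := by
    have h := real_inner_self_eq_norm_sq n
    rw [hn, EuclideanSpace.inner_eq_star_dotProduct] at h
    simpa using h
  have hden : HasDerivAt (fun ε : ℝ => 1 + ε * s) s 0 := by
    simpa using ((hasDerivAt_id (0 : ℝ)).mul_const s).const_add 1
  have hcoeff : HasDerivAt (fun ε : ℝ => ε / (1 + ε * s)) 1 0 := by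
    simpa using (hasDerivAt_id (0 : ℝ)).fun_div hden (by simp)
  have hcurve : HasDerivAt (fun ε : ℝ => n - (ε / (1 + ε * s)) • g) (-g) 0 := by
    simpa using (hcoeff.smul_const g).const_sub n
  have hvec : (fun ε : ℝ => Matrix.toEuclideanLin (((1 + ε • B)⁻¹)ᵀ) n) =ᶠ[nhds 0]
      fun ε => n - (ε / (1 + ε * s)) • g := by
    filter_upwards [hden.continuousAt.eventually_ne (by simp : 1 + (0 : ℝ) * s ≠ 0)] with ε hε
    rw [hB', inv_one_add_smul_vecMulVec _ _ _ hε]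
    apply WithLp.ofLp_injective 2
    simp [Matrix.toLpLin_apply, transpose_vecMulVec, vecMulVec_mulVec,
      hnn, s]
  have hderiv := (hcurve.congr_of_eventuallyEq hvec).norm_inv_smul_of_norm_eq_one (by simp [hn])
  refine HasDerivAt.congr_deriv hderiv ?_
  simp [real_inner_comm]
end
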